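/- Let W ⊆ ℂ be an open set, and let h : ℂ → ℂ be injective on W and complex-differentiable at every point of W, with 0 ∉ h(W). Let E ⊆ U ⊆ W be measurable sets and let C₁, C₂, C₃ ≥ 1 be constants such that: (i) Area(U) ≤ C₁·Area(E) (two-dimensional Lebesgue measure); (ii) |h′(z)| ≤ C₂·|h′(w)| for all z, w ∈ W; (iii) |h(z)| ≤ C₃·|h(w)| for all z, w ∈ W. Then Area(ρ_*, h(U)) ≤ C₁·C₂²·C₃²·Area(ρ_*, h(E)), i.e., ∫_{h(U)} 1/(4π²|w|²) dA(w) ≤ C₁·C₂²·C₃² · ∫_{h(E)} 1/(4π²|w|²) dA(w). -/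

import Mathlib

open MeasureTheory Real

/-- Change of variables for an injective holomorphic map: the real Jacobian is `‖h′‖ ^ 2`. -/
lemma lintegral_image_eq_lintegral_norm_deriv_sq_mul {h : ℂ → ℂ} {S : Set ℂ}
    (hS : MeasurableSet S) (hdiff : ∀ z ∈ S, DifferentiableAt ℂ h z) (hinj : Set.InjOn h S)
    (g : ℂ → ENNReal) :
    ∫⁻ w in h '' S, g w = ∫⁻ z in S, ENNReal.ofReal (‖deriv h z‖ ^ 2) * g (h z) := by
  rw [lintegral_image_eq_lintegral_abs_det_fderiv_mul volume hS
    (fun z hz => ((hdiff z hz).hasFDerivAt.restrictScalars ℝ).hasFDerivWithinAt) hinj]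
  refine setLIntegral_congr_fun hS fun z _ => ?_
  simp [ContinuousLinearMap.det, LinearMap.det_restrictScalars, Algebra.norm_complex_eq,
    Complex.normSq_eq_norm_sq]

/-- A density whose values on `U` are comparable up to a factor `K` has comparable integrals
over sets `E ⊆ U` of comparable measure. -/
lemma setLIntegral_le_mul_setLIntegral_of_comparable {α : Type*} [MeasurableSpace α]
    {μ : Measure α} {E U : Set α} (hEU : E ⊆ U) (hE : MeasurableSet E) (hU : MeasurableSet U)
    {C K : ENNReal} (hK : K ≠ ⊤) (hμ : μ U ≤ C * μ E) {g : α → ENNReal}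
    (hg : ∀ z ∈ U, ∀ w ∈ U, g z ≤ K * g w) :
    ∫⁻ z in U, g z ∂μ ≤ C * K * ∫⁻ z in E, g z ∂μ := by
  set S : ENNReal := ⨆ z ∈ U, g z
  calc ∫⁻ z in U, g z ∂μ ≤ ∫⁻ _ in U, S ∂μ :=
        setLIntegral_mono' hU fun z hz => le_iSup₂ (f := fun z (_ : z ∈ U) => g z) z hz
    _ = S * μ U := setLIntegral_const U S
    _ ≤ S * (C * μ E) := by gcongr
    _ = C * ∫⁻ _ in E, S ∂μ := by rw [setLIntegral_const]; ring
    _ ≤ C * ∫⁻ w in E, K * g w ∂μ := by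
        gcongr C * ?_
        exact setLIntegral_mono' hE fun w hw => iSup₂_le fun z hz => hg z hz w (hEU hw)
    _ = C * K * ∫⁻ z in E, g z ∂μ := by rw [lintegral_const_mul' K g hK, mul_assoc]

/-- Area comparison with respect to the flat metric
`ρ_*(w) = 1/(2π|w|)` on `ℂ*`.  Let `W ⊆ ℂ` be open, `h` injective on `W`,
complex-differentiable at every point of `W` and omitting `0` on `W`.  If
`E ⊆ U ⊆ W` are measurable, `Area(U) ≤ C₁·Area(E)`, `|h′| ≤ C₂·|h′|` and
`|h| ≤ C₃·|h|` uniformly on `W`, then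
`Area(ρ_*, h(U)) ≤ C₁·C₂²·C₃²·Area(ρ_*, h(E))`. -/
theorem rho_area_comparison (W : Set ℂ) (hWopen : IsOpen W) (h : ℂ → ℂ)
    (hinj : Set.InjOn h W) (hdiff : ∀ z ∈ W, DifferentiableAt ℂ h z)
    (h0 : (0 : ℂ) ∉ h '' W)
    (E U : Set ℂ) (hEU : E ⊆ U) (hUW : U ⊆ W)
    (hEm : MeasurableSet E) (hUm : MeasurableSet U)
    (C₁ C₂ C₃ : ℝ) (hC₁ : 1 ≤ C₁) (hC₂ : 1 ≤ C₂) (hC₃ : 1 ≤ C₃)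
    (harea : volume U ≤ ENNReal.ofReal C₁ * volume E)
    (hderiv : ∀ z ∈ W, ∀ w ∈ W, ‖deriv h z‖ ≤ C₂ * ‖deriv h w‖)
    (hval : ∀ z ∈ W, ∀ w ∈ W, ‖h z‖ ≤ C₃ * ‖h w‖) :
    ∫⁻ w in h '' U, ENNReal.ofReal (1 / (4 * π ^ 2 * ‖w‖ ^ 2)) ≤
      ENNReal.ofReal (C₁ * C₂ ^ 2 * C₃ ^ 2) *
        ∫⁻ w in h '' E, ENNReal.ofReal (1 / (4 * π ^ 2 * ‖w‖ ^ 2)) := by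
  have hne : ∀ z ∈ W, 0 < ‖h z‖ := fun z hz =>
    norm_pos_iff.mpr fun hz0 => h0 ⟨z, hz, hz0⟩
  rw [lintegral_image_eq_lintegral_norm_deriv_sq_mul hUm (fun z hz => hdiff z (hUW hz))
      (hinj.mono hUW),
    lintegral_image_eq_lintegral_norm_deriv_sq_mul hEm (fun z hz => hdiff z (hUW (hEU hz)))
      (hinj.mono (hEU.trans hUW)),
    mul_assoc C₁, ENNReal.ofReal_mul (by positivity)]
  refine setLIntegral_le_mul_setLIntegral_of_comparable hEU hEm hUm ENNReal.ofReal_ne_top harea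
    fun z hz w hw => ?_
  rw [← ENNReal.ofReal_mul (by positivity), ← ENNReal.ofReal_mul (by positivity),
    ← ENNReal.ofReal_mul (by positivity)]
  refine ENNReal.ofReal_le_ofReal ?_
  have hz' := hne z (hUW hz)
  have hw' := hne w (hUW hw)
  have hnum := pow_le_pow_left₀ (norm_nonneg _) (hderiv z (hUW hz) w (hUW hw)) 2
  have hden : 1 / (4 * π ^ 2 * ‖h z‖ ^ 2) ≤ C₃ ^ 2 * (1 / (4 * π ^ 2 * ‖h w‖ ^ 2)) := by
    rw [mul_one_div, div_le_div_iff₀ (by positivity) (by positivity)]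
    have hsq := pow_le_pow_left₀ (norm_nonneg _) (hval w (hUW hw) z (hUW hz)) 2
    calc 1 * (4 * π ^ 2 * ‖h w‖ ^ 2) ≤ 1 * (4 * π ^ 2 * (C₃ * ‖h z‖) ^ 2) := by gcongr
      _ = C₃ ^ 2 * (4 * π ^ 2 * ‖h z‖ ^ 2) := by ring
  calc ‖deriv h z‖ ^ 2 * (1 / (4 * π ^ 2 * ‖h z‖ ^ 2))
      ≤ (C₂ * ‖deriv h w‖) ^ 2 * (C₃ ^ 2 * (1 / (4 * π ^ 2 * ‖h w‖ ^ 2))) := by gcongr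
    _ = C₂ ^ 2 * C₃ ^ 2 * (‖deriv h w‖ ^ 2 * (1 / (4 * π ^ 2 * ‖h w‖ ^ 2))) := by ring
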